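/- arXiv:2303.06916 — 2 statements merged into one kernel-verified Lean document; each statement's English description precedes it below -/
import Mathlib

section
/- Maximal inequality (Proposition 3.6 of the paper). Let ξ = (ξ_t)_{t≥0} be a [0,∞)-valued continuous adapted process and f : [0,∞)² → [0,∞) a measurable function. For r > 0 let τ_r := inf{t ≥ 0 : ξ_t ≥ r} (with inf ∅ := +∞), and assume that the process (ξ_{t∧τ_r} − ∫₀^{t∧τ_r} f(u, ξ_u) du)_{t≥0} is a supermartingale. Then for any s ∈ (0,∞), almost surely P(sup_{0≤t≤s} ξ_t ≥ r | F₀) ≤ r⁻¹·(ξ₀ + E[∫₀^{s∧τ_r} f(u, ξ_u) du | F₀]). -/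
open MeasureTheory Filter Set
open scoped NNReal ENNReal

variable {Ω : Type*}

/-- `τ_r`, the first time at which `ξ` rises to level `r` or above (`∞` if never). -/
noncomputable def hitAbove (ξ : ℝ≥0 → Ω → ℝ≥0) (r : ℝ≥0) (ω : Ω) : ℝ≥0∞ :=
  sInf ((fun u : ℝ≥0 => (u : ℝ≥0∞)) '' {u : ℝ≥0 | r ≤ ξ u ω})

/-- The additive functional `∫₀^{t ∧ τ_r} f(u, ξ_u) du`. -/
noncomputable def addFun (ξ : ℝ≥0 → Ω → ℝ≥0) (f : ℝ≥0 → ℝ≥0 → ℝ≥0) (r : ℝ≥0)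
    (t : ℝ≥0) (ω : Ω) : ℝ :=
  ∫ u in Set.Ioc (0 : ℝ) (((min (t : ℝ≥0∞) (hitAbove ξ r ω)).toNNReal : ℝ)),
    (f u.toNNReal (ξ u.toNNReal ω) : ℝ)

theorem le_sSup_image_Icc_iff {x : ℝ≥0 → ℝ≥0} (hx : Continuous x) (r a : ℝ≥0) :
    r ≤ sSup (x '' Icc 0 a) ↔ ∃ u ≤ a, r ≤ x u := by
  have hc : IsCompact (x '' Icc 0 a) := isCompact_Icc.image hx
  have hne : (x '' Icc 0 a).Nonempty := ⟨x 0, 0, by simp, rfl⟩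
  constructor
  · intro h
    obtain ⟨u, hu, hxu⟩ := hc.sSup_mem hne
    exact ⟨u, hu.2, h.trans_eq hxu.symm⟩
  · rintro ⟨u, hu, hr⟩
    exact hr.trans (le_csSup hc.bddAbove (mem_image_of_mem x ⟨zero_le, hu⟩))

theorem hitAbove_le_coe_iff {ξ : ℝ≥0 → Ω → ℝ≥0} {ω : Ω} (hξ : Continuous fun t => ξ t ω)
    (r a : ℝ≥0) : hitAbove ξ r ω ≤ a ↔ ∃ u ≤ a, r ≤ ξ u ω := by
  constructor
  · intro h
    rcases {u : ℝ≥0 | r ≤ ξ u ω}.eq_empty_or_nonempty with hS | hS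
    · simp [hitAbove, hS] at h
    · have hmem : sInf {u : ℝ≥0 | r ≤ ξ u ω} ∈ {u : ℝ≥0 | r ≤ ξ u ω} :=
        (isClosed_le continuous_const hξ).csInf_mem hS (OrderBot.bddBelow _)
      refine ⟨_, ?_, hmem⟩
      rw [← ENNReal.coe_le_coe, ENNReal.coe_sInf hS, ← sInf_image]
      exact h
  · rintro ⟨u, hu, hr⟩
    exact sInf_le_of_le ⟨u, hr, rfl⟩ (ENNReal.coe_le_coe.2 hu)

theorem measurable_sSup_image_Icc {m : MeasurableSpace Ω} {ξ : ℝ≥0 → Ω → ℝ≥0}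
    (hm : ∀ t, Measurable (ξ t)) (hξ : ∀ ω, Continuous fun t => ξ t ω) (a : ℝ≥0) :
    Measurable fun ω => sSup ((fun t => ξ t ω) '' Icc 0 a) := by
  have : Nonempty (Icc 0 a) := ⟨⟨0, by simp⟩⟩
  refine measurable_of_Ioi fun c => ?_
  have h : (fun ω => sSup ((fun t => ξ t ω) '' Icc 0 a)) ⁻¹' Ioi c
      = ⋃ n, {ω | c < ξ (TopologicalSpace.denseSeq (Icc 0 a) n) ω} := by
    ext ω
    have hc : IsCompact ((fun t => ξ t ω) '' Icc 0 a) := isCompact_Icc.image (hξ ω)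
    rw [mem_preimage, mem_Ioi, lt_csSup_iff hc.bddAbove ⟨_, 0, by simp, rfl⟩, mem_iUnion]
    constructor
    · rintro ⟨_, ⟨u, hu, rfl⟩, hcu⟩
      have ho : IsOpen {v : Icc 0 a | c < ξ v ω} :=
        isOpen_lt continuous_const ((hξ ω).comp continuous_subtype_val)
      obtain ⟨n, hv⟩ :=
        (TopologicalSpace.denseRange_denseSeq (Icc 0 a)).exists_mem_open ho ⟨⟨u, hu⟩, hcu⟩
      exact ⟨n, hv⟩
    · rintro ⟨n, hn⟩
      exact ⟨_, ⟨_, (TopologicalSpace.denseSeq (Icc 0 a) n).2, rfl⟩, hn⟩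
  rw [h]
  exact MeasurableSet.iUnion fun n => measurableSet_lt measurable_const (hm _)

theorem measurable_min_hitAbove {m : MeasurableSpace Ω} {ξ : ℝ≥0 → Ω → ℝ≥0}
    (hm : ∀ t, Measurable (ξ t)) (hξ : ∀ ω, Continuous fun t => ξ t ω) (r s : ℝ≥0) :
    Measurable fun ω => (min (s : ℝ≥0∞) (hitAbove ξ r ω)).toNNReal := by
  refine measurable_of_Iic fun a => ?_
  have h : (fun ω => (min (s : ℝ≥0∞) (hitAbove ξ r ω)).toNNReal) ⁻¹' Iic a
      = {ω | s ≤ a} ∪ {ω | r ≤ sSup ((fun t => ξ t ω) '' Icc 0 a)} := by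
    ext ω
    have hfin : min (s : ℝ≥0∞) (hitAbove ξ r ω) ≠ ∞ :=
      ((min_le_left _ _).trans_lt ENNReal.coe_lt_top).ne
    rw [mem_preimage, mem_Iic, ← ENNReal.coe_le_coe, ENNReal.coe_toNNReal hfin, min_le_iff,
      hitAbove_le_coe_iff (hξ ω), mem_union, mem_ofPred_eq, mem_ofPred_eq,
      le_sSup_image_Icc_iff (hξ ω), ENNReal.coe_le_coe]
  rw [h]
  exact (MeasurableSet.const _).union
    (measurableSet_le measurable_const (measurable_sSup_image_Icc hm hξ a))

theorem measurable_stopped_hitAbove {m : MeasurableSpace Ω} {ξ : ℝ≥0 → Ω → ℝ≥0}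
    (hm : ∀ t, Measurable (ξ t)) (hξ : ∀ ω, Continuous fun t => ξ t ω) (r s : ℝ≥0) :
    Measurable fun ω => ξ (min (s : ℝ≥0∞) (hitAbove ξ r ω)).toNNReal ω :=
  (measurable_uncurry_of_continuous_of_measurable (u := ξ) hξ hm).comp
    ((measurable_min_hitAbove hm hξ r s).prodMk measurable_id)

theorem stopped_hitAbove_le {ξ : ℝ≥0 → Ω → ℝ≥0} {ω : Ω} (hξ : Continuous fun t => ξ t ω)
    (r s : ℝ≥0) : ξ (min (s : ℝ≥0∞) (hitAbove ξ r ω)).toNNReal ω ≤ max (ξ 0 ω) r := by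
  set T := (min (s : ℝ≥0∞) (hitAbove ξ r ω)).toNNReal with hT
  have hTle : (T : ℝ≥0∞) ≤ hitAbove ξ r ω :=
    ENNReal.coe_toNNReal_le_self.trans (min_le_right _ _)
  rcases eq_or_ne T 0 with h0 | h0
  · rw [h0]
    exact le_max_left _ _
  · refine le_trans ?_ (le_max_right _ _)
    have hsub : closure (Iio T) ⊆ {u | ξ u ω ≤ r} := by
      refine closure_minimal (fun u hu => ?_) (isClosed_le hξ continuous_const)
      by_contra hlt
      have hhit := (hitAbove_le_coe_iff hξ r u).2 ⟨u, le_rfl, (not_le.1 hlt).le⟩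
      exact (ENNReal.coe_le_coe.1 (hTle.trans hhit)).not_gt hu
    rw [closure_Iio' ⟨0, pos_iff_ne_zero.2 h0⟩] at hsub
    exact hsub (mem_Iic.2 le_rfl)

theorem le_stopped_hitAbove {ξ : ℝ≥0 → Ω → ℝ≥0} {ω : Ω} (hξ : Continuous fun t => ξ t ω)
    {r s : ℝ≥0} (h : r ≤ sSup ((fun t => ξ t ω) '' Icc 0 s)) :
    r ≤ ξ (min (s : ℝ≥0∞) (hitAbove ξ r ω)).toNNReal ω := by
  have hle := (hitAbove_le_coe_iff hξ r s).2 ((le_sSup_image_Icc_iff hξ r s).1 h)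
  rw [min_eq_right hle]
  have hfin : hitAbove ξ r ω ≠ ∞ := (hle.trans_lt ENNReal.coe_lt_top).ne
  obtain ⟨u, hu, hr⟩ :=
    (hitAbove_le_coe_iff hξ r _).1 (ENNReal.coe_toNNReal hfin).ge
  have hu' : (hitAbove ξ r ω).toNNReal ≤ u :=
    ENNReal.toNNReal_mono ENNReal.coe_ne_top (sInf_le ⟨u, hr, rfl⟩)
  rwa [le_antisymm hu' hu]

/-- **Maximal inequality** (Proposition 3.6): if
`(ξ_{t ∧ τ_r} − ∫₀^{t∧τ_r} f(u, ξ_u) du)_{t ≥ 0}` is a supermartingale, then for any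
`s ∈ (0,∞)`, almost surely
`P(sup_{0 ≤ t ≤ s} ξ_t ≥ r | F₀) ≤ r⁻¹ (ξ₀ + E[∫₀^{s ∧ τ_r} f(u, ξ_u) du | F₀])`. -/
theorem maximal_inequality
    {m0 : MeasurableSpace Ω} {μ : Measure Ω} [IsProbabilityMeasure μ]
    (ℱ : Filtration ℝ≥0 m0)
    (ξ : ℝ≥0 → Ω → ℝ≥0)
    (hadapt : ∀ t : ℝ≥0, Measurable[ℱ t] (ξ t))
    (hcont : ∀ ω, Continuous fun t => ξ t ω)
    (f : ℝ≥0 → ℝ≥0 → ℝ≥0)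
    (hf : Measurable fun p : ℝ≥0 × ℝ≥0 => f p.1 p.2)
    (r : ℝ≥0) (hr : 0 < r)
    (hsup : Supermartingale
      (fun (t : ℝ≥0) ω => ((ξ ((min ((t : ℝ≥0) : ℝ≥0∞) (hitAbove ξ r ω)).toNNReal) ω : ℝ)
        - addFun ξ f r t ω)) ℱ μ)
    (s : ℝ≥0) (hs : 0 < s) :
    μ[Set.indicator {ω | (r : ℝ≥0) ≤ sSup ((fun t => ξ t ω) '' Set.Icc 0 s)}
        (fun _ => (1 : ℝ)) | ℱ 0]
      ≤ᵐ[μ] fun ω => (r : ℝ)⁻¹ * ((ξ 0 ω : ℝ) + (μ[addFun ξ f r s | ℱ 0]) ω) := by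
  have hm (t : ℝ≥0) : Measurable (ξ t) := (hadapt t).mono (ℱ.le t) le_rfl
  set X : Ω → ℝ := fun ω => (ξ (min (s : ℝ≥0∞) (hitAbove ξ r ω)).toNNReal ω : ℝ) with hX
  set A : Set Ω := {ω | r ≤ sSup ((fun t => ξ t ω) '' Icc 0 s)} with hA_def
  have hA : MeasurableSet A :=
    measurableSet_le measurable_const (measurable_sSup_image_Icc hm hcont s)
  have hξ0 : Integrable (fun ω => (ξ 0 ω : ℝ)) μ := by
    simpa [addFun] using hsup.integrable 0
  have hXint : Integrable X μ := by
    refine (hξ0.sup (integrable_const (r : ℝ))).mono'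
      (measurable_stopped_hitAbove hm hcont r s).coe_nnreal_real.aestronglyMeasurable
      (Eventually.of_forall fun ω => ?_)
    rw [Real.norm_of_nonneg (NNReal.coe_nonneg _)]
    exact_mod_cast stopped_hitAbove_le (hcont ω) r s
  have hFint : Integrable (addFun ξ f r s) μ := by
    refine (hXint.sub (hsup.integrable s)).congr (Eventually.of_forall fun ω => ?_)
    simp [hX]
  have hmono : μ[A.indicator (fun _ => (1 : ℝ)) | ℱ 0] ≤ᵐ[μ] μ[(r : ℝ)⁻¹ • X | ℱ 0] := by
    refine condExp_mono ((integrable_const _).indicator hA) (hXint.smul _)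
      (Eventually.of_forall fun ω => ?_)
    refine indicator_le' (fun ω hω => ?_) (fun ω _ => ?_) ω
    · have hr' : (0 : ℝ) < r := hr
      have hle : (r : ℝ) ≤ X ω := NNReal.coe_le_coe.2 (le_stopped_hitAbove (hcont ω) hω)
      rw [Pi.smul_apply, smul_eq_mul, inv_mul_eq_div, one_le_div hr']
      exact hle
    · exact mul_nonneg (by positivity) (NNReal.coe_nonneg _)
  have hsub := condExp_sub hXint hFint (ℱ 0)
  have hle := hsup.condExp_ae_le (zero_le (a := s))
  filter_upwards [hmono, condExp_smul (μ := μ) (r : ℝ)⁻¹ X (ℱ 0), hsub, hle]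
    with ω h₁ h₂ h₃ h₄
  refine h₁.trans ?_
  rw [h₂, Pi.smul_apply, smul_eq_mul]
  refine mul_le_mul_of_nonneg_left ?_ (by positivity)
  have h₅ : (μ[X - addFun ξ f r s | ℱ 0]) ω ≤ (ξ 0 ω : ℝ) :=
    h₄.trans_eq (by simp [addFun])
  rw [h₃, Pi.sub_apply] at h₅
  linarith
end

section
/- Oscillating boundary function with zero growth exponent (Lemma C.1 of the paper). Let b : [0,∞) → ℝ be twice continuously differentiable on (0,∞) and satisfy b(x) = (log log x)·(1 + (log log x)^{−2} + sin(log log x)) for all x > exp(e+1). Then: limsup_{x→∞} b(x) = ∞; liminf_{x→∞} b(x) = 0; lim_{x→∞} x·b'(x)/b(x) = 0; and lim_{x→∞} b'(x) = lim_{x→∞} b''(x) = 0. -/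
open Real Filter Set Topology

theorem tendsto_log_log_atTop : Tendsto (fun x : ℝ => log (log x)) atTop atTop :=
  tendsto_log_atTop.comp tendsto_log_atTop

/-- A polynomial in `log log x` is negligible against `log x`. -/
theorem tendsto_sq_log_log_div_log :
    Tendsto (fun x : ℝ => 3 * (log (log x) + 4) ^ 2 / log x) atTop (𝓝 0) := by
  have h := ((tendsto_pow_mul_exp_neg_atTop_nhds_zero 2).comp
    (tendsto_atTop_add_const_right _ 4 tendsto_log_log_atTop)).const_mul (3 * exp 4)
  rw [mul_zero] at h
  refine h.congr' ?_
  filter_upwards [tendsto_log_atTop.eventually_gt_atTop 0] with x hx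
  have hexp : exp (-(log (log x) + 4)) = (exp 4)⁻¹ * (log x)⁻¹ := by
    rw [exp_neg, exp_add, exp_log hx, mul_inv, mul_comm]
  simp only [Function.comp_apply, hexp]
  field_simp

/-- The function `y ↦ y (1 + y⁻² + sin y)`. -/
noncomputable def oscProfile (y : ℝ) : ℝ := y * (1 + (y ^ 2)⁻¹ + sin y)

/-- The derivative of `oscProfile` away from `0`. -/
noncomputable def oscProfileDeriv (y : ℝ) : ℝ := 1 - (y ^ 2)⁻¹ + sin y + y * cos y

theorem hasDerivAt_oscProfile {y : ℝ} (hy : y ≠ 0) :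
    HasDerivAt oscProfile (oscProfileDeriv y) y := by
  have h := (hasDerivAt_id y).mul
    ((((hasDerivAt_pow 2 y).inv (pow_ne_zero 2 hy)).const_add 1).add (hasDerivAt_sin y))
  refine h.congr_deriv ?_
  simp only [oscProfileDeriv, id, Pi.add_apply, Pi.inv_apply]
  field_simp
  ring

theorem hasDerivAt_oscProfileDeriv {y : ℝ} (hy : y ≠ 0) :
    HasDerivAt oscProfileDeriv (2 * (y ^ 3)⁻¹ + 2 * cos y - y * sin y) y := by
  have h := ((((hasDerivAt_pow 2 y).inv (pow_ne_zero 2 hy)).const_sub 1).add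
    (hasDerivAt_sin y)).add ((hasDerivAt_id y).mul (hasDerivAt_cos y))
  refine h.congr_deriv ?_
  simp only [id]
  field_simp
  ring

theorem inv_le_oscProfile {y : ℝ} (hy : 0 < y) : y⁻¹ ≤ oscProfile y := by
  have h : oscProfile y = y⁻¹ + y * (1 + sin y) := by
    rw [oscProfile]
    field_simp
    ring
  rw [h]
  nlinarith [neg_one_le_sin y]

theorem abs_oscProfileDeriv_le {y : ℝ} (hy : 1 ≤ y) : |oscProfileDeriv y| ≤ y + 4 := by
  have h1 : (y ^ 2)⁻¹ ≤ 1 := inv_le_one_of_one_le₀ (one_le_pow₀ hy)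
  have h0 : 0 ≤ (y ^ 2)⁻¹ := by positivity
  rw [oscProfileDeriv, abs_le]
  constructor <;> nlinarith [neg_one_le_sin y, sin_le_one y, neg_one_le_cos y, cos_le_one y]

theorem abs_deriv_oscProfileDeriv_le {y : ℝ} (hy : 1 ≤ y) :
    |2 * (y ^ 3)⁻¹ + 2 * cos y - y * sin y| ≤ y + 4 := by
  have h1 : (y ^ 3)⁻¹ ≤ 1 := inv_le_one_of_one_le₀ (one_le_pow₀ hy)
  have h0 : 0 ≤ (y ^ 3)⁻¹ := by positivity
  rw [abs_le]
  constructor <;> nlinarith [neg_one_le_sin y, sin_le_one y, neg_one_le_cos y, cos_le_one y]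

theorem hasDerivAt_log_comp_log {x : ℝ} (hx : x ≠ 0) (hlog : log x ≠ 0) :
    HasDerivAt (fun x : ℝ => log (log x)) (x * log x)⁻¹ x := by
  refine ((hasDerivAt_log hx).log hlog).congr_deriv ?_
  field_simp

theorem hasDerivAt_oscProfile_log_log {x : ℝ} (hx : x ≠ 0) (hlog : log x ≠ 0)
    (hloglog : log (log x) ≠ 0) :
    HasDerivAt (fun x => oscProfile (log (log x)))
      (oscProfileDeriv (log (log x)) / (x * log x)) x :=
  ((hasDerivAt_oscProfile hloglog).comp (h₂ := oscProfile) x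
    (hasDerivAt_log_comp_log hx hlog)).congr_deriv (div_eq_mul_inv _ _).symm

theorem hasDerivAt_oscProfileDeriv_log_log_div {x : ℝ} (hx : x ≠ 0) (hlog : log x ≠ 0)
    (hloglog : log (log x) ≠ 0) :
    HasDerivAt (fun x => oscProfileDeriv (log (log x)) / (x * log x))
      (((2 * (log (log x) ^ 3)⁻¹ + 2 * cos (log (log x)) - log (log x) * sin (log (log x)))
        - oscProfileDeriv (log (log x)) * (log x + 1)) / (x * log x) ^ 2) x := by
  have h := ((hasDerivAt_oscProfileDeriv hloglog).comp x (hasDerivAt_log_comp_log hx hlog)).div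
    ((hasDerivAt_id x).mul (hasDerivAt_log hx)) (mul_ne_zero hx hlog)
  refine h.congr_deriv ?_
  simp only [id, Function.comp_apply, Pi.mul_apply]
  field_simp

theorem tendsto_exp_exp_add_two_pi_mul (c : ℝ) :
    Tendsto (fun n : ℕ => exp (exp (c + n * (2 * π)))) atTop atTop :=
  tendsto_exp_atTop.comp (tendsto_exp_atTop.comp
    (tendsto_atTop_add_const_left _ c
      (tendsto_natCast_atTop_atTop.atTop_mul_const two_pi_pos)))

/-- **Oscillating boundary function with zero growth exponent** (Lemma C.1): if `b` is
twice continuously differentiable on `(0,∞)` and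
`b(x) = log log x (1 + (log log x)^{−2} + sin log log x)` for `x > exp(e+1)`, then
`limsup_{x→∞} b(x) = ∞`, `liminf_{x→∞} b(x) = 0`, `x b'(x)/b(x) → 0`, `b'(x) → 0`
and `b''(x) → 0` as `x → ∞`. -/
theorem oscillating_boundary_function (b : ℝ → ℝ)
    (hb : ContDiffOn ℝ 2 b (Ioi (0 : ℝ)))
    (hbeq : ∀ x : ℝ, Real.exp (Real.exp 1 + 1) < x →
      b x = Real.log (Real.log x) *
        (1 + ((Real.log (Real.log x)) ^ 2)⁻¹ + Real.sin (Real.log (Real.log x)))) :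
    Filter.limsup (fun x => ((b x : ℝ) : EReal)) atTop = ⊤ ∧
    Filter.liminf (fun x => ((b x : ℝ) : EReal)) atTop = (0 : EReal) ∧
    Tendsto (fun x => x * deriv b x / b x) atTop (𝓝 0) ∧
    Tendsto (deriv b) atTop (𝓝 0) ∧
    Tendsto (deriv (deriv b)) atTop (𝓝 0) := by
  have hb_eq : ∀ᶠ x in atTop, b x = oscProfile (log (log x)) :=
    (eventually_gt_atTop _).mono hbeq
  have hx1 : ∀ᶠ x : ℝ in atTop, 1 ≤ x := eventually_ge_atTop 1
  have hL1 : ∀ᶠ x : ℝ in atTop, 1 ≤ log x := tendsto_log_atTop.eventually_ge_atTop 1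
  have hy1 : ∀ᶠ x : ℝ in atTop, 1 ≤ log (log x) := tendsto_log_log_atTop.eventually_ge_atTop 1
  have hderiv : ∀ᶠ x in atTop, deriv b x = oscProfileDeriv (log (log x)) / (x * log x) := by
    filter_upwards [eventually_gt_atTop (exp (exp 1 + 1)), hx1, hL1, hy1] with x hx hx1 hL hy
    have heq : b =ᶠ[𝓝 x] fun x => oscProfile (log (log x)) :=
      (eventually_gt_nhds hx).mono hbeq
    rw [heq.deriv_eq]
    exact (hasDerivAt_oscProfile_log_log (by positivity) (by positivity) (by positivity)).deriv
  obtain ⟨a, ha⟩ := eventually_atTop.1 hderiv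
  have hseq (c : ℝ) : ∀ᶠ n : ℕ in atTop,
      oscProfile (c + n * (2 * π)) = b (exp (exp (c + n * (2 * π)))) :=
    ((tendsto_exp_exp_add_two_pi_mul c).eventually hb_eq).mono fun n hn => by
      simpa only [log_exp] using hn.symm
  have harg (c : ℝ) : Tendsto (fun n : ℕ => c + n * (2 * π)) atTop atTop :=
    tendsto_atTop_add_const_left _ c (tendsto_natCast_atTop_atTop.atTop_mul_const two_pi_pos)
  refine ⟨?_, ?_, ?_, ?_, ?_⟩
  · have hlim : Tendsto (fun n : ℕ => b (exp (exp (π / 2 + n * (2 * π))))) atTop atTop := by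
      refine (tendsto_atTop_mono' _ ?_ (harg (π / 2))).congr' (hseq _)
      filter_upwards [(harg (π / 2)).eventually_ge_atTop 0] with n hn
      rw [oscProfile, sin_add_nat_mul_two_pi, sin_pi_div_two]
      exact le_mul_of_one_le_right hn
        (by linarith [inv_nonneg.2 (sq_nonneg (π / 2 + n * (2 * π)))])
    have hE := EReal.tendsto_coe_nhds_top_iff.2 hlim
    rw [eq_top_iff, ← hE.limsup_eq]
    exact limsup_le_limsup_of_le (tendsto_exp_exp_add_two_pi_mul (π / 2))
      (u := fun x => (b x : EReal))
  · have hlim : Tendsto (fun n : ℕ => b (exp (exp (-(π / 2) + n * (2 * π))))) atTop (𝓝 0) := by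
      refine (tendsto_inv_atTop_zero.comp (harg (-(π / 2)))).congr' ?_
      filter_upwards [hseq (-(π / 2)), (harg (-(π / 2))).eventually_gt_atTop 0] with n hn hpos
      rw [← hn, oscProfile, sin_add_nat_mul_two_pi, sin_neg, sin_pi_div_two, Function.comp_apply]
      generalize -(π / 2) + n * (2 * π) = y at hpos
      field_simp
      ring
    have hE : Tendsto (fun n : ℕ => (b (exp (exp (-(π / 2) + n * (2 * π)))) : EReal)) atTop
        (𝓝 0) := EReal.tendsto_coe.2 hlim
    apply le_antisymm
    · rw [← hE.liminf_eq]
      exact liminf_le_liminf_of_le (tendsto_exp_exp_add_two_pi_mul (-(π / 2)))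
        (u := fun x => (b x : EReal))
    · refine le_liminf_of_le (by isBoundedDefault) ?_
      filter_upwards [hb_eq, hy1] with x hx hy
      rw [hx]
      exact EReal.coe_nonneg.2 ((by positivity : 0 ≤ (log (log x))⁻¹).trans
        (inv_le_oscProfile (by positivity)))
  · refine squeeze_zero_norm' ?_ tendsto_sq_log_log_div_log
    filter_upwards [hb_eq, hderiv, hx1, hL1, hy1] with x hbx hdx hx hL hy
    have hG := abs_oscProfileDeriv_le hy
    have hg := inv_le_oscProfile (by positivity : 0 < log (log x))
    have hg0 : 0 < oscProfile (log (log x)) := lt_of_lt_of_le (by positivity) hg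
    have hquot : x * deriv b x / b x =
        oscProfileDeriv (log (log x)) * (oscProfile (log (log x)))⁻¹ / log x := by
      rw [hbx, hdx]
      field_simp
    rw [hquot, norm_eq_abs, abs_div, abs_mul, abs_of_pos (inv_pos.2 hg0),
      abs_of_pos (by positivity : 0 < log x)]
    refine div_le_div_of_nonneg_right ?_ (by positivity)
    calc |oscProfileDeriv (log (log x))| * (oscProfile (log (log x)))⁻¹
        ≤ (log (log x) + 4) * log (log x) := by
          gcongr
          exact inv_le_of_inv_le₀ (by positivity) hg
      _ ≤ 3 * (log (log x) + 4) ^ 2 := by nlinarith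
  · refine squeeze_zero_norm' ?_ tendsto_sq_log_log_div_log
    filter_upwards [hderiv, hx1, hL1, hy1] with x hdx hx hL hy
    have hG := abs_oscProfileDeriv_le hy
    rw [hdx, norm_eq_abs, abs_div, abs_of_pos (by positivity : 0 < x * log x)]
    gcongr
    · nlinarith
    · nlinarith
  · refine squeeze_zero_norm' ?_ tendsto_sq_log_log_div_log
    filter_upwards [eventually_gt_atTop a, hx1, hL1, hy1] with x hax hx hL hy
    have hG := abs_oscProfileDeriv_le hy
    have hG' := abs_deriv_oscProfileDeriv_le hy
    have heq : deriv b =ᶠ[𝓝 x] fun x => oscProfileDeriv (log (log x)) / (x * log x) :=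
      (eventually_gt_nhds hax).mono fun z hz => ha z hz.le
    rw [heq.deriv_eq, (hasDerivAt_oscProfileDeriv_log_log_div (by positivity) (by positivity)
      (by positivity)).deriv, norm_eq_abs, abs_div,
      abs_of_pos (by positivity : 0 < (x * log x) ^ 2)]
    have hnum := abs_sub
      (2 * (log (log x) ^ 3)⁻¹ + 2 * cos (log (log x)) - log (log x) * sin (log (log x)))
      (oscProfileDeriv (log (log x)) * (log x + 1))
    rw [abs_mul, abs_of_pos (by positivity : 0 < log x + 1)] at hnum
    rw [div_le_div_iff₀ (by positivity) (by positivity)]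
    have hbound : |(2 * (log (log x) ^ 3)⁻¹ + 2 * cos (log (log x))
          - log (log x) * sin (log (log x)))
        - oscProfileDeriv (log (log x)) * (log x + 1)| ≤ 3 * (log (log x) + 4) ^ 2 * log x := by
      have h1 : |oscProfileDeriv (log (log x))| * (log x + 1)
          ≤ (log (log x) + 4) * (2 * log x) := by
        gcongr
        linarith
      have h2 : log (log x) + 4 ≤ (log (log x) + 4) * log x :=
        le_mul_of_one_le_right (by positivity) hL
      have h3 : (log (log x) + 4) * log x ≤ (log (log x) + 4) ^ 2 * log x := by
        gcongr
        nlinarith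
      linarith
    calc _ ≤ 3 * (log (log x) + 4) ^ 2 * log x * log x := by gcongr
      _ = 3 * (log (log x) + 4) ^ 2 * (1 * log x) ^ 2 := by ring
      _ ≤ 3 * (log (log x) + 4) ^ 2 * (x * log x) ^ 2 := by gcongr
end
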